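/- Let n, p ∈ ℕ, β, h, h̃ ∈ ℝ^p, f, f̃ ∈ ℝⁿ, ψ, ψ̃ ∈ ℝⁿ, and let H, H̃ ∈ ℝ^{n×p} with columns h_j, h̃_j (j = 1,…,p). Let Ψ be an n×n real symmetric positive definite matrix and Ψ̃ an n×n matrix. Let δ > 0, set r = δ·κ(Ψ) where κ(Ψ) = ‖Ψ‖₂‖Ψ⁻¹‖₂, and assume r < 1 together with the perturbation bounds ‖h − h̃‖₂ ≤ δ‖h‖₂, ‖f − f̃‖₂ ≤ δ‖f‖₂, ‖h_j − h̃_j‖₂ ≤ δ‖h_j‖₂ for all j, ‖Ψ − Ψ̃‖₂ ≤ δ‖Ψ‖₂, and ‖ψ − ψ̃‖₂ ≤ δ‖ψ‖₂. Then Ψ̃ is invertible and the nominal and numeric predictors f̂ = h'β + ψ'Ψ⁻¹(f − Hβ) and f̃^ = h̃'β + ψ̃'Ψ̃⁻¹(f̃ − H̃β) satisfy |f̂ − f̃^| ≤ δ‖h‖₂‖β‖₂ + (2δ/(1−r))·‖ψ‖₂·(‖f‖₂ + ‖β‖₂·√(Σ_{j=1}^p ‖h_j‖₂²))·(κ(Ψ)+1)/λ_min(Ψ).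 -/

import Mathlib

open Matrix

/-- The Euclidean norm of a vector. -/
noncomputable def euclNorm {n : ℕ} (v : Fin n → ℝ) : ℝ :=
  Real.sqrt (∑ i, v i ^ 2)

/-- The spectral (operator) norm of a matrix, induced by the Euclidean vector norm. -/
noncomputable def specNorm {n : ℕ} (A : Matrix (Fin n) (Fin n) ℝ) : ℝ :=
  sSup {r : ℝ | ∃ v : Fin n → ℝ, euclNorm v = 1 ∧ r = euclNorm (A *ᵥ v)}

/-- The smallest eigenvalue of a symmetric matrix, characterized as the infimum of its
Rayleigh quotient over Euclidean unit vectors. -/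
noncomputable def lamMin {n : ℕ} (A : Matrix (Fin n) (Fin n) ℝ) : ℝ :=
  sInf {r : ℝ | ∃ v : Fin n → ℝ, (∑ i, v i ^ 2) = 1 ∧ r = v ⬝ᵥ (A *ᵥ v)}

section EuclNorm

variable {n p : ℕ}

theorem euclNorm_eq_norm (v : Fin n → ℝ) : euclNorm v = ‖WithLp.toLp 2 v‖ := by
  simp [euclNorm, EuclideanSpace.norm_eq]

theorem euclNorm_nonneg (v : Fin n → ℝ) : 0 ≤ euclNorm v := Real.sqrt_nonneg _

theorem euclNorm_sq (v : Fin n → ℝ) : euclNorm v ^ 2 = ∑ i, v i ^ 2 :=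
  Real.sq_sqrt (Finset.sum_nonneg fun _ _ => sq_nonneg _)

theorem dotProduct_self_eq_euclNorm_sq (v : Fin n → ℝ) : v ⬝ᵥ v = euclNorm v ^ 2 := by
  rw [euclNorm_sq]
  exact Finset.sum_congr rfl fun i _ => (sq (v i)).symm

theorem euclNorm_eq_zero {v : Fin n → ℝ} : euclNorm v = 0 ↔ v = 0 := by
  rw [euclNorm_eq_norm, norm_eq_zero, WithLp.toLp_eq_zero]

theorem euclNorm_sub_le (v w : Fin n → ℝ) : euclNorm (v - w) ≤ euclNorm v + euclNorm w := by
  simpa only [euclNorm_eq_norm, WithLp.toLp_sub] using norm_sub_le _ _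

theorem euclNorm_smul (c : ℝ) (v : Fin n → ℝ) : euclNorm (c • v) = |c| * euclNorm v := by
  rw [euclNorm_eq_norm, euclNorm_eq_norm, WithLp.toLp_smul, norm_smul, Real.norm_eq_abs]

theorem abs_dotProduct_le (v w : Fin n → ℝ) : |v ⬝ᵥ w| ≤ euclNorm v * euclNorm w := by
  refine abs_le_of_sq_le_sq ?_ (mul_nonneg (euclNorm_nonneg v) (euclNorm_nonneg w))
  rw [mul_pow, euclNorm_sq, euclNorm_sq]
  exact Finset.sum_mul_sq_le_sq_mul_sq _ _ _

theorem euclNorm_mulVec_le_frobenius (A : Matrix (Fin n) (Fin p) ℝ) (v : Fin p → ℝ) :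
    euclNorm (A *ᵥ v) ≤ euclNorm v * Real.sqrt (∑ j, (euclNorm fun i => A i j) ^ 2) := by
  refine le_of_sq_le_sq ?_ (mul_nonneg (euclNorm_nonneg v) (Real.sqrt_nonneg _))
  rw [mul_pow, Real.sq_sqrt (Finset.sum_nonneg fun _ _ => sq_nonneg _), euclNorm_sq (A *ᵥ v)]
  simp only [euclNorm_sq]
  rw [Finset.sum_comm, Finset.mul_sum]
  refine Finset.sum_le_sum fun i _ => ?_
  rw [mul_comm]
  exact Finset.sum_mul_sq_le_sq_mul_sq Finset.univ (A i) v

end EuclNorm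

section SpecNorm

variable {n : ℕ}

theorem euclNorm_mulVec_le (A : Matrix (Fin n) (Fin n) ℝ) (v : Fin n → ℝ) :
    euclNorm (A *ᵥ v) ≤ specNorm A * euclNorm v := by
  rcases (euclNorm_nonneg v).eq_or_lt with h0 | hpos
  · rw [← h0, euclNorm_eq_zero.1 h0.symm, mulVec_zero, mul_zero, euclNorm_eq_zero.2 rfl]
  · have hbdd : BddAbove {r : ℝ | ∃ v : Fin n → ℝ, euclNorm v = 1 ∧ r = euclNorm (A *ᵥ v)} := by
      refine ⟨Real.sqrt (∑ j, (euclNorm fun i => A i j) ^ 2), ?_⟩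
      rintro _ ⟨w, hw, rfl⟩
      simpa [hw] using euclNorm_mulVec_le_frobenius A w
    have habs : |(euclNorm v)⁻¹| = (euclNorm v)⁻¹ := abs_of_pos (inv_pos.2 hpos)
    have h := le_csSup hbdd ⟨(euclNorm v)⁻¹ • v, by
      rw [euclNorm_smul, habs, inv_mul_cancel₀ hpos.ne'], rfl⟩
    rw [mulVec_smul, euclNorm_smul, habs, inv_mul_le_iff₀ hpos] at h
    rwa [mul_comm]

theorem specNorm_nonneg (A : Matrix (Fin n) (Fin n) ℝ) : 0 ≤ specNorm A := by
  refine Real.sSup_nonneg ?_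
  rintro _ ⟨v, -, rfl⟩
  exact euclNorm_nonneg _

theorem exists_euclNorm_eq_one [NeZero n] : ∃ v : Fin n → ℝ, euclNorm v = 1 :=
  ⟨Pi.single 0 1, by rw [euclNorm_eq_norm]; simp⟩

theorem one_le_specNorm_mul_specNorm_inv [NeZero n] {A : Matrix (Fin n) (Fin n) ℝ}
    (hA : IsUnit A.det) : 1 ≤ specNorm A * specNorm A⁻¹ := by
  obtain ⟨v, hv⟩ := exists_euclNorm_eq_one (n := n)
  calc 1 = euclNorm (A *ᵥ (A⁻¹ *ᵥ v)) := by
        rw [mulVec_mulVec, mul_nonsing_inv _ hA, one_mulVec, hv]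
    _ ≤ specNorm A * euclNorm (A⁻¹ *ᵥ v) := euclNorm_mulVec_le _ _
    _ ≤ specNorm A * (specNorm A⁻¹ * euclNorm v) :=
      mul_le_mul_of_nonneg_left (euclNorm_mulVec_le _ _) (specNorm_nonneg A)
    _ = specNorm A * specNorm A⁻¹ := by rw [hv, mul_one]

theorem specNorm_inv_pos [NeZero n] {A : Matrix (Fin n) (Fin n) ℝ} (hA : IsUnit A.det) :
    0 < specNorm A⁻¹ :=
  pos_of_mul_pos_right (zero_lt_one.trans_le (one_le_specNorm_mul_specNorm_inv hA))
    (specNorm_nonneg A)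

theorem Matrix.PosDef.inv_specNorm_inv_le_lamMin [NeZero n] {A : Matrix (Fin n) (Fin n) ℝ}
    (hA : A.PosDef) : (specNorm A⁻¹)⁻¹ ≤ lamMin A := by
  have hdet : IsUnit A.det := hA.det_pos.ne'.isUnit
  have hsymm : Aᵀ = A := by simpa [IsHermitian] using hA.isHermitian
  have hL : specNorm A⁻¹ ≠ 0 := (specNorm_inv_pos hdet).ne'
  obtain ⟨e, he⟩ := exists_euclNorm_eq_one (n := n)
  refine le_csInf ⟨_, e, by rw [← euclNorm_sq, he, one_pow], rfl⟩ ?_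
  rintro _ ⟨v, hv, rfl⟩
  rw [← euclNorm_sq] at hv
  have hv1 : euclNorm v = 1 := by nlinarith [euclNorm_nonneg v]
  set L := specNorm A⁻¹
  set u := A⁻¹ *ᵥ v with hu
  have hAu : A *ᵥ u = v := by rw [hu, mulVec_mulVec, mul_nonsing_inv _ hdet, one_mulVec]
  have hvv : v ⬝ᵥ v = 1 := by rw [dotProduct_self_eq_euclNorm_sq, hv]
  have huAv : u ⬝ᵥ A *ᵥ v = 1 := by
    rw [dotProduct_mulVec, ← mulVec_transpose, hsymm, hAu, hvv]
  have huv : u ⬝ᵥ v ≤ L := by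
    have h1 := (le_abs_self _).trans (abs_dotProduct_le u v)
    have h2 := euclNorm_mulVec_le A⁻¹ v
    rw [hv1, mul_one] at h1 h2
    exact h1.trans h2
  have hpos : 0 ≤ (v - L⁻¹ • u) ⬝ᵥ A *ᵥ (v - L⁻¹ • u) := by
    simpa using hA.posSemidef.dotProduct_mulVec_nonneg (v - L⁻¹ • u)
  simp only [mulVec_sub, mulVec_smul, hAu, sub_dotProduct, dotProduct_sub, smul_dotProduct,
    dotProduct_smul, smul_eq_mul, hvv, huAv] at hpos
  have hle : L⁻¹ * (L⁻¹ * (u ⬝ᵥ v)) ≤ L⁻¹ * (L⁻¹ * L) := by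
    have : 0 ≤ L⁻¹ := inv_nonneg.2 (specNorm_nonneg _)
    gcongr
  rw [inv_mul_cancel₀ hL] at hle
  linarith

/-- The smallest eigenvalue of a positive definite matrix is at most the inverse of the spectral
norm of its inverse. -/
theorem Matrix.PosDef.specNorm_inv_le_inv_lamMin [NeZero n] {A : Matrix (Fin n) (Fin n) ℝ}
    (hA : A.PosDef) : specNorm A⁻¹ ≤ (lamMin A)⁻¹ := by
  have hdet : IsUnit A.det := hA.det_pos.ne'.isUnit
  have hlam : 0 < lamMin A :=
    (inv_pos.2 (specNorm_inv_pos hdet)).trans_le hA.inv_specNorm_inv_le_lamMin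
  obtain ⟨e, he⟩ := exists_euclNorm_eq_one (n := n)
  refine csSup_le ⟨_, e, he, rfl⟩ ?_
  rintro _ ⟨v, hv, rfl⟩
  set w := A⁻¹ *ᵥ v with hw
  have hAw : A *ᵥ w = v := by rw [hw, mulVec_mulVec, mul_nonsing_inv _ hdet, one_mulVec]
  rcases (euclNorm_nonneg w).eq_or_lt with h0 | hpos
  · rw [← h0]
    exact (inv_pos.2 hlam).le
  · have hbdd : BddBelow {r : ℝ | ∃ v : Fin n → ℝ, (∑ i, v i ^ 2) = 1 ∧ r = v ⬝ᵥ (A *ᵥ v)} := by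
      refine ⟨0, ?_⟩
      rintro _ ⟨x, -, rfl⟩
      simpa using hA.posSemidef.dotProduct_mulVec_nonneg x
    have hray : lamMin A ≤ _ := csInf_le hbdd ⟨(euclNorm w)⁻¹ • w, by
      rw [← euclNorm_sq, euclNorm_smul, abs_of_pos (inv_pos.2 hpos), inv_mul_cancel₀ hpos.ne',
        one_pow], rfl⟩
    have hwv : w ⬝ᵥ v ≤ euclNorm w := by
      simpa [hv] using (le_abs_self _).trans (abs_dotProduct_le w v)
    rw [mulVec_smul, hAw, smul_dotProduct, dotProduct_smul, smul_eq_mul, smul_eq_mul] at hray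
    rw [le_inv_comm₀ hpos hlam]
    calc lamMin A ≤ (euclNorm w)⁻¹ * ((euclNorm w)⁻¹ * (w ⬝ᵥ v)) := hray
      _ ≤ (euclNorm w)⁻¹ * ((euclNorm w)⁻¹ * euclNorm w) := by gcongr
      _ = (euclNorm w)⁻¹ := by rw [inv_mul_cancel₀ hpos.ne', mul_one]

theorem euclNorm_le_specNorm_inv_mul {A : Matrix (Fin n) (Fin n) ℝ} (hA : IsUnit A.det)
    (v : Fin n → ℝ) : euclNorm v ≤ specNorm A⁻¹ * euclNorm (A *ᵥ v) := by
  simpa [mulVec_mulVec, nonsing_inv_mul _ hA] using euclNorm_mulVec_le A⁻¹ (A *ᵥ v)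

/-- A perturbation of relative size less than the inverse condition number keeps a matrix
invertible. -/
theorem isUnit_of_specNorm_sub_le {A B : Matrix (Fin n) (Fin n) ℝ} {δ : ℝ} (hA : IsUnit A.det)
    (hr : δ * (specNorm A * specNorm A⁻¹) < 1) (hB : specNorm (A - B) ≤ δ * specNorm A) :
    IsUnit B := by
  rw [← mulVec_injective_iff_isUnit]
  refine (injective_iff_map_eq_zero B.mulVecLin).2 fun x hx => ?_
  have hBx : B *ᵥ x = 0 := hx
  have h1 := euclNorm_le_specNorm_inv_mul hA x
  have h2 := euclNorm_mulVec_le (A - B) x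
  rw [sub_mulVec, hBx, sub_zero] at h2
  have h3 : euclNorm x ≤ specNorm A⁻¹ * (δ * specNorm A * euclNorm x) := by
    refine h1.trans (mul_le_mul_of_nonneg_left (h2.trans ?_) (specNorm_nonneg _))
    exact mul_le_mul_of_nonneg_right hB (euclNorm_nonneg x)
  exact euclNorm_eq_zero.1 (by nlinarith [euclNorm_nonneg x])

/-- Perturbation bound for `A x = g` against `B y = g'`, tested against perturbed functionals
`ψ`, `ψ'`. -/
theorem abs_dotProduct_sub_dotProduct_le {A B : Matrix (Fin n) (Fin n) ℝ}
    {x y ψ ψ' : Fin n → ℝ} {δ G : ℝ} (hA : IsUnit A.det) (hδ : 0 ≤ δ)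
    (hκ : 1 ≤ specNorm A * specNorm A⁻¹) (hr : δ * (specNorm A * specNorm A⁻¹) < 1)
    (hB : specNorm (A - B) ≤ δ * specNorm A) (hψ : euclNorm (ψ - ψ') ≤ δ * euclNorm ψ)
    (hG : euclNorm (A *ᵥ x) ≤ G) (hG' : euclNorm (A *ᵥ x - B *ᵥ y) ≤ δ * G) :
    |ψ ⬝ᵥ x - ψ' ⬝ᵥ y| ≤ 2 * δ / (1 - δ * (specNorm A * specNorm A⁻¹)) * euclNorm ψ * G *
      ((specNorm A * specNorm A⁻¹ + 1) * specNorm A⁻¹) := by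
  set L := specNorm A⁻¹
  set r := δ * (specNorm A * L) with hrdef
  have hL : 0 ≤ L := specNorm_nonneg _
  have hδr : δ ≤ r := le_mul_of_one_le_right hδ hκ
  have hr1 : 0 < 1 - r := sub_pos.2 hr
  have hG0 : 0 ≤ G := (euclNorm_nonneg _).trans hG
  have hx : euclNorm x ≤ L * G :=
    (euclNorm_le_specNorm_inv_mul hA x).trans (mul_le_mul_of_nonneg_left hG hL)
  have hxy : euclNorm (x - y) ≤ δ * (L * G) + r * euclNorm y := by
    have hAxy : A *ᵥ (x - y) = (A *ᵥ x - B *ᵥ y) - (A - B) *ᵥ y := by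
      rw [mulVec_sub, sub_mulVec]; abel
    have h1 := euclNorm_sub_le (A *ᵥ x - B *ᵥ y) ((A - B) *ᵥ y)
    have h2 := (euclNorm_mulVec_le (A - B) y).trans
      (mul_le_mul_of_nonneg_right hB (euclNorm_nonneg y))
    calc euclNorm (x - y) ≤ L * euclNorm (A *ᵥ (x - y)) := euclNorm_le_specNorm_inv_mul hA _
      _ ≤ L * (δ * G + δ * specNorm A * euclNorm y) := by
        rw [hAxy]; exact mul_le_mul_of_nonneg_left (by linarith) hL
      _ = δ * (L * G) + r * euclNorm y := by rw [hrdef]; ring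
  have hy : (1 - r) * euclNorm y ≤ (1 + δ) * (L * G) := by
    have h := euclNorm_sub_le x (x - y)
    rw [sub_sub_cancel] at h
    linarith
  have hsum : (1 - r) * (euclNorm (x - y) + δ * euclNorm y) ≤ (2 * δ + 2 * r) * (L * G) := by
    have hLG : 0 ≤ L * G := mul_nonneg hL hG0
    have h1 := mul_le_mul_of_nonneg_left hxy hr1.le
    have h2 := mul_le_mul_of_nonneg_left hy (add_nonneg (hδ.trans hδr) hδ)
    have h3 : δ * δ ≤ r := by nlinarith
    have h4 := mul_le_mul_of_nonneg_right h3 hLG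
    nlinarith
  have hdecomp : ψ ⬝ᵥ x - ψ' ⬝ᵥ y = ψ ⬝ᵥ (x - y) + (ψ - ψ') ⬝ᵥ y := by
    rw [dotProduct_sub, sub_dotProduct]; ring
  have hy0 := euclNorm_nonneg y
  calc |ψ ⬝ᵥ x - ψ' ⬝ᵥ y| ≤ |ψ ⬝ᵥ (x - y)| + |(ψ - ψ') ⬝ᵥ y| := by
        rw [hdecomp]; exact abs_add_le _ _
    _ ≤ euclNorm ψ * euclNorm (x - y) + euclNorm (ψ - ψ') * euclNorm y :=
        add_le_add (abs_dotProduct_le _ _) (abs_dotProduct_le _ _)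
    _ ≤ euclNorm ψ * euclNorm (x - y) + δ * euclNorm ψ * euclNorm y := by gcongr
    _ = euclNorm ψ * (euclNorm (x - y) + δ * euclNorm y) := by ring
    _ ≤ euclNorm ψ * ((2 * δ + 2 * r) * (L * G) / (1 - r)) :=
        mul_le_mul_of_nonneg_left ((le_div_iff₀' hr1).2 hsum) (euclNorm_nonneg ψ)
    _ = 2 * δ / (1 - r) * euclNorm ψ * G * ((specNorm A * L + 1) * L) := by
        rw [hrdef]; ring

end SpecNorm

/-- Numeric error bound for the Gaussian process BLUP: under relative floating point
accuracy `δ` for all inputs, and `r = δκ(Ψ) < 1`, the floating point matrix `Ψ'` is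
invertible and the deviation between the nominal predictor
`f̂ = h'β + ψ'Ψ⁻¹(f − Hβ)` and its numeric counterpart is bounded by
`δ‖h‖‖β‖ + (2δ/(1−r))‖ψ‖(‖f‖ + ‖β‖√(Σⱼ‖hⱼ‖²))(κ(Ψ)+1)/λ_min(Ψ)`. -/
theorem numeric_error_bound {n p : ℕ}
    (β h h' : Fin p → ℝ) (f f' ψ ψ' : Fin n → ℝ)
    (H H' : Matrix (Fin n) (Fin p) ℝ)
    (Ψ : Matrix (Fin n) (Fin n) ℝ) (hΨ : Ψ.PosDef)
    (Ψ' : Matrix (Fin n) (Fin n) ℝ)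
    (δ r : ℝ) (hδ : 0 < δ)
    (hr : r = δ * (specNorm Ψ * specNorm Ψ⁻¹)) (hr1 : r < 1)
    (hh : euclNorm (h - h') ≤ δ * euclNorm h)
    (hf : euclNorm (f - f') ≤ δ * euclNorm f)
    (hcols : ∀ j : Fin p,
      euclNorm ((fun i => H i j) - fun i => H' i j) ≤ δ * euclNorm fun i => H i j)
    (hΨpert : specNorm (Ψ - Ψ') ≤ δ * specNorm Ψ)
    (hψpert : euclNorm (ψ - ψ') ≤ δ * euclNorm ψ) :
    IsUnit Ψ' ∧
      |(h ⬝ᵥ β + ψ ⬝ᵥ (Ψ⁻¹ *ᵥ (f - H *ᵥ β))) -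
          (h' ⬝ᵥ β + ψ' ⬝ᵥ (Ψ'⁻¹ *ᵥ (f' - H' *ᵥ β)))| ≤
        δ * euclNorm h * euclNorm β +
          (2 * δ / (1 - r)) * euclNorm ψ *
            (euclNorm f +
              euclNorm β * Real.sqrt (∑ j, (euclNorm fun i => H i j) ^ 2)) *
            ((specNorm Ψ * specNorm Ψ⁻¹ + 1) / lamMin Ψ) := by
  have hdet : IsUnit Ψ.det := hΨ.det_pos.ne'.isUnit
  have hunit : IsUnit Ψ' := isUnit_of_specNorm_sub_le hdet (hr ▸ hr1) hΨpert
  refine ⟨hunit, ?_⟩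
  have hdet' : IsUnit Ψ'.det := (isUnit_iff_isUnit_det Ψ').1 hunit
  have hreg : |h ⬝ᵥ β - h' ⬝ᵥ β| ≤ δ * euclNorm h * euclNorm β := by
    rw [← sub_dotProduct]
    exact (abs_dotProduct_le _ _).trans (mul_le_mul_of_nonneg_right hh (euclNorm_nonneg β))
  set F := Real.sqrt (∑ j, (euclNorm fun i => H i j) ^ 2) with hF
  set G := euclNorm f + euclNorm β * F
  set x := Ψ⁻¹ *ᵥ (f - H *ᵥ β) with hx
  set y := Ψ'⁻¹ *ᵥ (f' - H' *ᵥ β) with hy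
  have hcov : |ψ ⬝ᵥ x - ψ' ⬝ᵥ y| ≤ 2 * δ / (1 - r) * euclNorm ψ * G *
      ((specNorm Ψ * specNorm Ψ⁻¹ + 1) / lamMin Ψ) := by
    rcases n.eq_zero_or_pos with rfl | hn
    · simp [euclNorm]
    · have : NeZero n := ⟨hn.ne'⟩
      have hΨx : Ψ *ᵥ x = f - H *ᵥ β := by
        rw [hx, mulVec_mulVec, mul_nonsing_inv _ hdet, one_mulVec]
      have hΨy : Ψ' *ᵥ y = f' - H' *ᵥ β := by
        rw [hy, mulVec_mulVec, mul_nonsing_inv _ hdet', one_mulVec]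
      have hG : euclNorm (Ψ *ᵥ x) ≤ G := by
        rw [hΨx]
        linarith [euclNorm_sub_le f (H *ᵥ β), euclNorm_mulVec_le_frobenius H β]
      have hfrob : Real.sqrt (∑ j, (euclNorm fun i => (H - H') i j) ^ 2) ≤ δ * F := by
        refine Real.sqrt_le_iff.2 ⟨mul_nonneg hδ.le (Real.sqrt_nonneg _), ?_⟩
        rw [mul_pow, hF, Real.sq_sqrt (Finset.sum_nonneg fun _ _ => sq_nonneg _), Finset.mul_sum]
        refine Finset.sum_le_sum fun j _ => ?_
        rw [← mul_pow]
        exact pow_le_pow_left₀ (euclNorm_nonneg _) (hcols j) 2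
      have hG' : euclNorm (Ψ *ᵥ x - Ψ' *ᵥ y) ≤ δ * G := by
        have hsplit : Ψ *ᵥ x - Ψ' *ᵥ y = (f - f') - (H - H') *ᵥ β := by
          rw [hΨx, hΨy, sub_mulVec]; abel
        rw [hsplit]
        calc euclNorm ((f - f') - (H - H') *ᵥ β)
            ≤ euclNorm (f - f') + euclNorm ((H - H') *ᵥ β) := euclNorm_sub_le _ _
          _ ≤ δ * euclNorm f + euclNorm β * (δ * F) :=
            add_le_add hf ((euclNorm_mulVec_le_frobenius _ _).trans
              (mul_le_mul_of_nonneg_left hfrob (euclNorm_nonneg β)))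
          _ = δ * G := by ring
      have hbound := abs_dotProduct_sub_dotProduct_le hdet hδ.le
        (one_le_specNorm_mul_specNorm_inv hdet) (hr ▸ hr1) hΨpert hψpert hG hG'
      rw [← hr] at hbound
      refine hbound.trans (mul_le_mul_of_nonneg_left ?_ ?_)
      · rw [div_eq_mul_inv]
        exact mul_le_mul_of_nonneg_left hΨ.specNorm_inv_le_inv_lamMin
          (by linarith [one_le_specNorm_mul_specNorm_inv hdet])
      · have := (euclNorm_nonneg _).trans hG
        exact mul_nonneg (mul_nonneg (div_nonneg (by linarith) (by linarith))
          (euclNorm_nonneg ψ)) this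
  calc |(h ⬝ᵥ β + ψ ⬝ᵥ x) - (h' ⬝ᵥ β + ψ' ⬝ᵥ y)|
      = |(h ⬝ᵥ β - h' ⬝ᵥ β) + (ψ ⬝ᵥ x - ψ' ⬝ᵥ y)| := by rw [add_sub_add_comm]
    _ ≤ |h ⬝ᵥ β - h' ⬝ᵥ β| + |ψ ⬝ᵥ x - ψ' ⬝ᵥ y| := abs_add_le _ _
    _ ≤ _ := add_le_add hreg hcov
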